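/- Let 0 < t_1 ≤ t_2, ρ = t_2/t_1, ψ_{nk}(x) = He_k(x/√t_n)/√(k!), S_1 ~ N(0,t_1), S_2 = S_1 + Z with Z ~ N(0, t_2−t_1) independent. Then E[ψ_{2,k_2}(S_2)^2 ψ_{1,k_1}(S_1)^2] = Σ_{k=0}^{min(k_1,k_2)} ρ^{-k} C(2k,k) C(k_1,k) C(k_2,k), where C(n,k) denotes a binomial coefficient. -/

import Mathlib

open Finset MeasureTheory ProbabilityTheory

/-- Probabilists' Hermite polynomial, via its explicit sum formula. -/
noncomputable def He (n : ℕ) (x : ℝ) : ℝ :=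
  ∑ i ∈ Finset.range (n / 2 + 1),
    (-1 : ℝ) ^ i * (Nat.factorial n : ℝ) * x ^ (n - 2 * i) /
      ((Nat.factorial (n - 2 * i) : ℝ) * (Nat.factorial i : ℝ) * 2 ^ i)

/-- Normalized Hermite basis functions `ψ_{nk}(x) = He_k(x/√t)/√(k!)`. -/
noncomputable def psi (t : ℝ) (k : ℕ) (x : ℝ) : ℝ :=
  He k (x / Real.sqrt t) / Real.sqrt (Nat.factorial k)

open Polynomial in
/-- Hermite polynomials as real polynomials. -/
noncomputable def hp : ℕ → ℝ[X]
  | 0 => 1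
  | n + 1 => X * hp n - derivative (hp n)

section aux
open Polynomial

lemma hp_deriv (n : ℕ) : derivative (hp (n + 1)) = ((n : ℝ) + 1) • hp n := by
  induction n with
  | zero => simp [hp]
  | succ n ih =>
    rw [hp, derivative_sub, derivative_mul, ih]
    simp only [derivative_X, derivative_smul, one_mul]
    rw [show hp (n + 1) = X * hp n - derivative (hp n) from rfl]
    simp only [smul_eq_C_mul]
    push_cast
    simp only [map_add, map_one]
    ring

/-- The raising operator. -/
noncomputable def raiseOp : ℝ[X] →ₗ[ℝ] ℝ[X] := LinearMap.mulLeft ℝ X - derivative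

lemma raiseOp_apply (p : ℝ[X]) : raiseOp p = X * p - derivative p := rfl

lemma hp_mul (m : ℕ) (g : ℝ[X]) :
    hp m * g = ∑ ij ∈ antidiagonal m,
      m.choose ij.1 • (raiseOp^[ij.2] (derivative^[ij.1] g)) := by
  induction m generalizing g with
  | zero => simp [hp]
  | succ m ih =>
    have h1 : hp (m + 1) * g = raiseOp (hp m * g) + hp m * derivative g := by
      rw [raiseOp_apply, derivative_mul, hp]; ring
    rw [sum_antidiagonal_choose_succ_nsmul
      (fun i j => raiseOp^[j] (derivative^[i] g)) m, h1, ih, ih, map_sum]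
    congr 1
    · refine sum_congr rfl fun ij _ => ?_
      rw [map_nsmul, Function.iterate_succ_apply']
    · refine sum_congr rfl fun ij hij => ?_
      rw [Nat.choose_symm_of_eq_add (mem_antidiagonal.1 hij).symm, Function.iterate_succ_apply]

lemma raiseOp_iter (j n : ℕ) : raiseOp^[j] (hp n) = hp (n + j) := by
  induction j with
  | zero => rfl
  | succ j ih => rw [Function.iterate_succ_apply', ih]; rfl

lemma raiseOp_iter_smul (j : ℕ) (c : ℝ) (p : ℝ[X]) : raiseOp^[j] (c • p) = c • raiseOp^[j] p := by
  induction j with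
  | zero => rfl
  | succ j ih => rw [Function.iterate_succ_apply', ih, map_smul, Function.iterate_succ_apply']

lemma deriv_iter (i j : ℕ) :
    derivative^[i] (hp (j + i)) = ((i + j).factorial / j.factorial : ℝ) • hp j := by
  induction i with
  | zero =>
    have : (j.factorial : ℝ) ≠ 0 := by positivity
    simp [this]
  | succ i ih =>
    rw [Function.iterate_succ_apply, ← add_assoc, hp_deriv, iterate_derivative_smul, ih, smul_smul]
    congr 1
    rw [show i + 1 + j = (i + j) + 1 by ring, Nat.factorial_succ]
    push_cast
    ring

lemma hp_sq (n : ℕ) :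
    hp n ^ 2 = ∑ i ∈ range (n + 1),
      (n.factorial * n.choose i / i.factorial : ℝ) • hp (2 * i) := by
  rw [sq, hp_mul, Nat.sum_antidiagonal_eq_sum_range_succ
    (fun i j => n.choose i • (raiseOp^[j] (derivative^[i] (hp n)))), ← sum_range_reflect]
  refine sum_congr rfl fun i hi => ?_
  have hi' : i ≤ n := by simpa [Nat.lt_succ_iff] using hi
  obtain ⟨d, rfl⟩ := Nat.exists_eq_add_of_le hi'
  rw [show i + d + 1 - 1 - i = d by omega, show i + d - d = i by omega, deriv_iter,
    raiseOp_iter_smul, raiseOp_iter, ← two_mul, Nat.choose_symm_add, ← Nat.cast_smul_eq_nsmul ℝ,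
    smul_smul, add_comm d i]
  congr 1
  ring

/-- summand of He -/
noncomputable def heTerm (n i : ℕ) (x : ℝ) : ℝ :=
  if 2 * i ≤ n then (-1 : ℝ) ^ i * (Nat.factorial n : ℝ) * x ^ (n - 2 * i) /
      ((Nat.factorial (n - 2 * i) : ℝ) * (Nat.factorial i : ℝ) * 2 ^ i) else 0

lemma He_eq_sum (n N : ℕ) (h : n / 2 + 1 ≤ N) (x : ℝ) :
    He n x = ∑ i ∈ range N, heTerm n i x := by
  have h1 : He n x = ∑ i ∈ range (n / 2 + 1), heTerm n i x := by
    refine sum_congr rfl fun i hi => ?_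
    rw [Finset.mem_range] at hi
    rw [heTerm, if_pos (by omega)]
  rw [h1]
  refine sum_subset (range_mono h) fun i _ hi => ?_
  rw [Finset.mem_range] at hi
  rw [heTerm, if_neg (by omega)]

lemma heTerm_rec (n i : ℕ) (x : ℝ) :
    heTerm (n + 2) (i + 1) x = x * heTerm (n + 1) (i + 1) x - (n + 1) * heTerm n i x := by
  unfold heTerm
  by_cases h1 : 2 * i ≤ n
  · obtain ⟨m, rfl⟩ := Nat.exists_eq_add_of_le h1
    rw [if_pos (show 2 * (i + 1) ≤ 2 * i + m + 2 by omega), if_pos h1]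
    cases m with
    | zero =>
      rw [if_neg (show ¬ 2 * (i + 1) ≤ 2 * i + 0 + 1 by omega)]
      simp only [add_zero, mul_add, mul_one, Nat.sub_self, Nat.factorial_succ, pow_succ]
      have : (i.factorial : ℝ) ≠ 0 := by positivity
      have : (i : ℝ) + 1 ≠ 0 := by positivity
      push_cast
      field_simp
      ring
    | succ m =>
      rw [if_pos (show 2 * (i + 1) ≤ 2 * i + (m + 1) + 1 by omega), show 2 * i + (m + 1) + 2 - 2 * (i + 1) = m + 1 by omega,
        show 2 * i + (m + 1) + 1 - 2 * (i + 1) = m by omega,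
        show 2 * i + (m + 1) - 2 * i = m + 1 by omega]
      simp only [Nat.factorial_succ, pow_succ]
      have : (i.factorial : ℝ) ≠ 0 := by positivity
      have : (m.factorial : ℝ) ≠ 0 := by positivity
      have : (i : ℝ) + 1 ≠ 0 := by positivity
      have : (m : ℝ) + 1 ≠ 0 := by positivity
      push_cast
      field_simp
      ring
  · rw [if_neg (by omega), if_neg (by omega), if_neg (by omega)]; ring

lemma He_rec (n : ℕ) (x : ℝ) : He (n + 2) x = x * He (n + 1) x - (n + 1) * He n x := by
  rw [He_eq_sum (n + 2) (n + 4) (by omega), He_eq_sum (n + 1) (n + 4) (by omega),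
    He_eq_sum n (n + 3) (by omega), sum_range_succ', sum_range_succ' (fun i => heTerm (n+1) i x)]
  simp only [heTerm_rec, sum_sub_distrib, ← mul_sum]
  have : heTerm (n + 2) 0 x = x * heTerm (n + 1) 0 x := by
    simp only [heTerm, Nat.mul_zero, Nat.zero_le, if_true, Nat.sub_zero, Nat.factorial_zero]
    have h2 : ((n + 2).factorial : ℝ) ≠ 0 := by positivity
    have h2 : ((n + 1).factorial : ℝ) ≠ 0 := by positivity
    field_simp
    ring
  rw [this]; ring

lemma He_eq_hp (n : ℕ) (x : ℝ) : He n x = (hp n).eval x ∧ He (n + 1) x = (hp (n + 1)).eval x := by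
  induction n with
  | zero => constructor <;> simp [He, hp]
  | succ n ih =>
    refine ⟨ih.2, ?_⟩
    rw [He_rec, ih.1, ih.2, show hp (n + 1 + 1) = X * hp (n + 1) - derivative (hp (n + 1)) from rfl,
      hp_deriv]
    simp

lemma integrable_poly (v : NNReal) (p : ℝ[X]) :
    Integrable (fun x => p.eval x) (gaussianReal 0 v) := by
  induction p using Polynomial.induction_on' with
  | add p q hp hq => exact (hp.add hq).congr (ae_of_all _ fun x => by simp)
  | monomial n a =>
    simp only [eval_monomial]
    refine Integrable.const_mul ?_ a
    have := integrable_pow_of_mem_interior_integrableExpSet (X := id) (μ := gaussianReal 0 v)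
      (by simp) n
    simpa using this

lemma stein (v : NNReal) (p : ℝ[X]) :
    ∫ x, x * p.eval x ∂(gaussianReal 0 v) = v * ∫ x, p.derivative.eval x ∂(gaussianReal 0 v) := by
  by_cases hv : v = 0
  · subst hv; simp
  have hv' : (v : ℝ) ≠ 0 := by exact_mod_cast hv
  have key : ∀ q : ℝ[X], Integrable (fun x => gaussianPDFReal 0 v x * q.eval x) := by
    intro q
    have := integrable_poly v q
    rw [gaussianReal_of_var_ne_zero _ hv, integrable_withDensity_iff_integrable_smul'
      (measurable_gaussianPDF _ _) (ae_of_all _ fun x => gaussianPDF_lt_top)] at this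
    simpa using this
  have hd : ∀ x, HasDerivAt (fun x => gaussianPDFReal 0 v x * (C (v:ℝ) * p).eval x)
      (gaussianPDFReal 0 v x * (C (v:ℝ) * derivative p - X * p).eval x) x := by
    intro x
    have h1 : HasDerivAt (gaussianPDFReal 0 v) (gaussianPDFReal 0 v x * (- x / v)) x := by
      rw [gaussianPDFReal_def]
      have : HasDerivAt (fun x : ℝ => -(x - 0) ^ 2 / (2 * v)) (-x / v) x := by
        have := ((((hasDerivAt_id x).sub_const 0).pow 2).neg).div_const (2 * (v : ℝ))
        refine this.congr_deriv ?_
        simp; field_simp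
      refine ((this.exp).const_mul ((√(2 * Real.pi * v))⁻¹)).congr_deriv ?_
      ring
    refine (h1.mul ((C (v:ℝ) * p).hasDerivAt x)).congr_deriv ?_
    simp; field_simp; ring
  have h0 := integral_eq_zero_of_hasDerivAt_of_integrable hd (key _) (key _)
  have h1 : ∫ x, (C (v:ℝ) * derivative p - X * p).eval x ∂(gaussianReal 0 v) = 0 := by
    rw [integral_gaussianReal_eq_integral_smul hv]; simpa using h0
  simp only [eval_sub] at h1
  rw [integral_sub (integrable_poly v _) (integrable_poly v _)] at h1
  simp only [eval_mul, eval_C, eval_X, integral_const_mul] at h1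
  linarith

/-- Affine substitution. -/
lemma stein_aff (v : NNReal) (p : ℝ[X]) (a b : ℝ) :
    ∫ z, z * p.eval (a + b * z) ∂(gaussianReal 0 v)
      = v * b * ∫ z, p.derivative.eval (a + b * z) ∂(gaussianReal 0 v) := by
  have := stein v (p.comp (C a + C b * X))
  simp only [derivative_comp, eval_comp, eval_mul, eval_add, eval_C, eval_X, derivative_add,
    derivative_C, derivative_mul, derivative_X, zero_mul, zero_add, mul_one,
    integral_const_mul] at this
  rw [this]; ring

lemma integrable_aff (v : NNReal) (p : ℝ[X]) (a b : ℝ) :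
    Integrable (fun z => p.eval (a + b * z)) (gaussianReal 0 v) := by
  exact (integrable_poly v (p.comp (C a + C b * X))).congr (ae_of_all _ fun x => by simp)

lemma integrable_aff' (v : NNReal) (p : ℝ[X]) (a b : ℝ) :
    Integrable (fun z => z * p.eval (a + b * z)) (gaussianReal 0 v) := by
  exact (integrable_poly v (X * p.comp (C a + C b * X))).congr (ae_of_all _ fun x => by simp)

/-- One step of the recursion for Gaussian averages. -/
lemma avg_step (v : NNReal) (a b : ℝ) (p : ℝ[X]) :
    ∫ z, (X * p - derivative p).eval (a + b * z) ∂(gaussianReal 0 v)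
      = a * ∫ z, p.eval (a + b * z) ∂(gaussianReal 0 v)
        - (1 - v * b ^ 2) * ∫ z, p.derivative.eval (a + b * z) ∂(gaussianReal 0 v) := by
  have : ∀ z, (X * p - derivative p).eval (a + b * z) =
      a * p.eval (a + b * z) + b * (z * p.eval (a + b * z)) - p.derivative.eval (a + b * z) := by
    intro z; simp; ring
  simp only [this]
  rw [integral_sub, integral_add, integral_const_mul, integral_const_mul, stein_aff]
  · ring
  · exact (integrable_aff v p a b).const_mul _
  · exact (integrable_aff' v p a b).const_mul _
  · exact ((integrable_aff v p a b).const_mul _).add ((integrable_aff' v p a b).const_mul _)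
  · exact integrable_aff v _ a b

lemma martingale_pair (v : NNReal) (y b r : ℝ) (hr : 1 - v * b ^ 2 = r ^ 2) (n : ℕ) :
    ∫ z, (hp n).eval (r * y + b * z) ∂(gaussianReal 0 v) = r ^ n * (hp n).eval y ∧
    ∫ z, (hp (n + 1)).eval (r * y + b * z) ∂(gaussianReal 0 v)
      = r ^ (n + 1) * (hp (n + 1)).eval y := by
  induction n with
  | zero =>
    have h0 : ∫ z, (hp 0).eval (r * y + b * z) ∂(gaussianReal 0 v) = r ^ 0 * (hp 0).eval y := by
      simp [hp]
    refine ⟨h0, ?_⟩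
    rw [hp, avg_step, h0]
    simp [hp]
  | succ n ih =>
    refine ⟨ih.2, ?_⟩
    rw [hp, avg_step, ih.2, hp_deriv, hr]
    simp only [eval_smul, smul_eq_mul, integral_const_mul, ih.1, eval_sub, eval_mul, eval_X]
    ring

/-- Integration against the Gaussian: raising operator is adjoint to the derivative. -/
lemma orth (v : NNReal) (b : ℝ) (hb : v * b ^ 2 = 1) (m n : ℕ) :
    ∫ z, (hp m).eval (b * z) * (hp n).eval (b * z) ∂(gaussianReal 0 v)
      = if m = n then (n.factorial : ℝ) else 0 := by
  have gen : ∀ p q : ℝ[X], ∫ z, (X * p - derivative p).eval (b * z) * q.eval (b * z)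
      ∂(gaussianReal 0 v) = ∫ z, p.eval (b * z) * q.derivative.eval (b * z) ∂(gaussianReal 0 v) := by
    intro p q
    have h := avg_step v 0 b (p * q)
    simp only [zero_add, hb, sub_self, zero_mul] at h
    have h2 : ∀ z, (X * (p * q) - derivative (p * q)).eval (b * z) =
      (((X * p - derivative p) * q).eval (b * z) - (p * derivative q).eval (b * z)) := by
      intro z; simp; ring
    simp only [h2] at h
    rw [integral_sub (by simpa only [zero_add] using integrable_aff v ((X * p - derivative p) * q) 0 b)
      (by simpa only [zero_add] using integrable_aff v (p * derivative q) 0 b)] at h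
    simp only [eval_mul] at h
    linarith
  induction m generalizing n with
  | zero =>
    cases n with
    | zero => simp [hp]
    | succ n =>
      have := gen (hp n) 1
      simp only [derivative_one, eval_zero, mul_zero, integral_zero, eval_one, mul_one] at this
      simpa [hp] using this
  | succ m ih =>
    rw [hp, gen]
    cases n with
    | zero => simp [hp]
    | succ n =>
      simp only [hp_deriv, eval_smul, smul_eq_mul, mul_left_comm _ ((n:ℝ) + 1), integral_const_mul, ih]
      by_cases h : m = n
      · simp [h, Nat.factorial_succ]
      · simp [h]

lemma psi_sq (t : ℝ) (k : ℕ) (x : ℝ) : (psi t k x) ^ 2 =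
    ∑ i ∈ range (k + 1), (k.choose i / i.factorial : ℝ) * (hp (2 * i)).eval (x / √t) := by
  have hk : (k.factorial : ℝ) ≠ 0 := by positivity
  rw [psi, (He_eq_hp k _).1, div_pow, Real.sq_sqrt (by positivity), ← eval_pow, hp_sq,
    eval_finsetSum, sum_div]
  refine sum_congr rfl fun i _ => ?_
  rw [eval_smul, smul_eq_mul]
  field_simp

end aux

theorem hermite_fourth_moment (t₁ t₂ : ℝ) (ht₁ : 0 < t₁) (ht : t₁ ≤ t₂) (k₁ k₂ : ℕ) :
    (∫ x, ∫ z, (psi t₂ k₂ (x + z)) ^ 2 * (psi t₁ k₁ x) ^ 2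
        ∂(gaussianReal 0 (Real.toNNReal (t₂ - t₁))) ∂(gaussianReal 0 (Real.toNNReal t₁)))
      = ∑ k ∈ Finset.range (min k₁ k₂ + 1),
          (t₂ / t₁) ^ (-(k : ℝ)) * (Nat.choose (2 * k) k : ℝ) *
            (Nat.choose k₁ k : ℝ) * (Nat.choose k₂ k : ℝ) := by
  have ht₂ : 0 < t₂ := lt_of_lt_of_le ht₁ ht
  have s1 : 0 < √t₁ := Real.sqrt_pos.2 ht₁
  have s2 : 0 < √t₂ := Real.sqrt_pos.2 ht₂
  have q1 : √t₁ ^ 2 = t₁ := Real.sq_sqrt ht₁.le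
  have q2 : √t₂ ^ 2 = t₂ := Real.sq_sqrt ht₂.le
  have inner : ∀ x, ∫ z, (psi t₂ k₂ (x + z)) ^ 2 * (psi t₁ k₁ x) ^ 2
      ∂(gaussianReal 0 (Real.toNNReal (t₂ - t₁))) =
      ∑ i ∈ range (k₂ + 1), ∑ j ∈ range (k₁ + 1),
        ((k₂.choose i / i.factorial : ℝ) * (t₁ / t₂) ^ i * (k₁.choose j / j.factorial : ℝ)) *
        ((hp (2 * i)).eval ((√t₁)⁻¹ * x) * (hp (2 * j)).eval ((√t₁)⁻¹ * x)) := by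
    intro x
    rw [integral_mul_const]
    have e : ∀ z, (x + z) / √t₂ = (√t₁ / √t₂) * ((√t₁)⁻¹ * x) + (√t₂)⁻¹ * z := by
      intro z; field_simp
    simp only [psi_sq, e]
    rw [integral_finsetSum _ (fun i _ => (integrable_aff _ _ _ _).const_mul _), sum_mul_sum]
    refine sum_congr rfl fun i _ => sum_congr rfl fun j _ => ?_
    rw [integral_const_mul, (martingale_pair _ _ _ _ ?_ _).1, pow_mul, div_pow, q1, q2,
      div_eq_inv_mul x]
    · ring
    · rw [Real.coe_toNNReal _ (by linarith), inv_pow, div_pow, q1, q2]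
      field_simp; ring
  simp only [inner]
  have hint : ∀ i j, Integrable (fun x => (Polynomial.eval ((√t₁)⁻¹ * x) (hp (2 * i)) *
      Polynomial.eval ((√t₁)⁻¹ * x) (hp (2 * j)))) (gaussianReal 0 (Real.toNNReal t₁)) := by
    intro i j
    simpa using integrable_aff (Real.toNNReal t₁) (hp (2 * i) * hp (2 * j)) 0 ((√t₁)⁻¹)
  rw [integral_finsetSum _ fun i _ => integrable_finsetSum _ fun j _ => (hint i j).const_mul _]
  have hb : ((Real.toNNReal t₁ : NNReal) : ℝ) * ((√t₁)⁻¹) ^ 2 = 1 := by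
    rw [Real.coe_toNNReal _ ht₁.le, inv_pow, q1]; field_simp
  have step : ∀ i ∈ range (k₂ + 1), (∫ x, ∑ j ∈ range (k₁ + 1),
        ((k₂.choose i / i.factorial : ℝ) * (t₁ / t₂) ^ i * (k₁.choose j / j.factorial : ℝ)) *
        ((hp (2 * i)).eval ((√t₁)⁻¹ * x) * (hp (2 * j)).eval ((√t₁)⁻¹ * x))
        ∂(gaussianReal 0 (Real.toNNReal t₁))) =
      (t₂ / t₁) ^ (-(i : ℝ)) * (Nat.choose (2 * i) i : ℝ) *
            (Nat.choose k₁ i : ℝ) * (Nat.choose k₂ i : ℝ) := by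
    intro i _
    rw [integral_finsetSum _ fun j _ => (hint i j).const_mul _]
    simp only [integral_const_mul, orth _ _ hb]
    have hc : ((2 * i).choose i : ℝ) * i.factorial * i.factorial = (2 * i).factorial := by
      have := Nat.choose_mul_factorial_mul_factorial (n := 2 * i) (k := i) (by omega)
      rw [show 2 * i - i = i by omega] at this
      exact_mod_cast this
    have hr : (t₂ / t₁) ^ (-(i : ℝ)) = (t₁ / t₂) ^ i := by
      rw [Real.rpow_neg (by positivity), Real.rpow_natCast, ← inv_pow, inv_div]
    have hi : (i.factorial : ℝ) ≠ 0 := by positivity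
    rw [hr]
    have : ∀ j, (2 * i = 2 * j) ↔ (i = j) := fun j => by omega
    simp only [this, mul_ite, mul_zero, sum_ite_eq]
    split_ifs with h
    · rw [← hc]; field_simp
    · rw [Nat.choose_eq_zero_of_lt (n := k₁) (k := i) (by simpa using h)]; simp
  rw [sum_congr rfl step]
  symm
  refine sum_subset (range_mono (by omega)) fun i hi hi' => ?_
  rw [Finset.mem_range] at hi hi'
  rw [Nat.choose_eq_zero_of_lt (n := k₁) (k := i) (by omega)]; simp
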